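/- arXiv:2410.17949 — 2 statements merged into one kernel-verified Lean document; each statement's English description precedes it below -/
import Mathlib

section
/- Let N be a finite set, δ ≥ 2 an integer, x̄ : N → ℝ, and X̄ a real-valued function on finite multisets over N with X̄_{{j}} = x̄_j for every j ∈ N. Let w(j,J) > 0 be strictly positive weights, and define for each j ∈ N the branching score θ_j = ∑_{J : 1 ≤ |J| ≤ δ−1} w(j,J) · |X̄_{J+{j}} − x̄_j · X̄_J|, the sum running over the finitely many multisets J over N with 1 ≤ |J| ≤ δ−1. If θ_j = 0 for every j ∈ N, then X̄_J = ∏_{j∈J} x̄_j for every multiset J with 1 ≤ |J| ≤ δ. -/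
/-- Over a finite type, there are finitely many multisets of bounded cardinality. -/
theorem Multiset.finite_setOf_card_le (α : Type*) [Finite α] (n : ℕ) :
    {s : Multiset α | Multiset.card s ≤ n}.Finite := by
  classical
  have := Fintype.ofFinite α
  refine ((Set.finite_Iic n).biUnion fun k _ =>
    Set.finite_range fun s : Sym α k => (s : Multiset α)).subset fun s hs => ?_
  exact Set.mem_biUnion (x := Multiset.card s) hs ⟨⟨s, rfl⟩, rfl⟩

/-- A vanishing finite sum of nonnegative terms has only zero terms. -/
theorem eq_zero_of_finsum_mem_eq_zero {α : Type*} {s : Set α} (hs : s.Finite) {f : α → ℝ}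
    (hf : ∀ a ∈ s, 0 ≤ f a) (h : ∑ᶠ a ∈ s, f a = 0) {a : α} (ha : a ∈ s) : f a = 0 := by
  rw [finsum_mem_eq_finite_toFinset_sum f hs] at h
  exact (Finset.sum_eq_zero_iff_of_nonneg fun b hb => hf b (hs.mem_toFinset.mp hb)).mp h a
    (hs.mem_toFinset.mpr ha)

/-- If all branching scores
`θ_j = ∑_{J : 1 ≤ |J| ≤ δ−1} w(j,J) · |Xb_{J+{j}} − xb_j · Xb_J|` (with strictly
positive weights) vanish, then all RLT identities up to degree `δ` hold. -/
theorem branching_scores_zero_sum {N : Type*} [Fintype N]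
    (δ : ℕ) (hδ : 2 ≤ δ) (xb : N → ℝ) (Xb : Multiset N → ℝ)
    (hX1 : ∀ j : N, Xb ({j} : Multiset N) = xb j)
    (w : N → Multiset N → ℝ)
    (hw : ∀ (j : N) (J : Multiset N), 1 ≤ Multiset.card J → Multiset.card J ≤ δ - 1 →
      0 < w j J)
    (hθ : ∀ j : N,
      (∑ᶠ J ∈ {J : Multiset N | 1 ≤ Multiset.card J ∧ Multiset.card J ≤ δ - 1},
        w j J * |Xb (j ::ₘ J) - xb j * Xb J|) = 0) :
    ∀ J : Multiset N, 1 ≤ Multiset.card J → Multiset.card J ≤ δ →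
      Xb J = (J.map xb).prod := by
  have hrec (j : N) (J : Multiset N) (h1 : 1 ≤ Multiset.card J)
      (h2 : Multiset.card J ≤ δ - 1) : Xb (j ::ₘ J) = xb j * Xb J := by
    have h := eq_zero_of_finsum_mem_eq_zero
      ((Multiset.finite_setOf_card_le N (δ - 1)).subset fun _ hJ => hJ.2)
      (fun J hJ => mul_nonneg (hw j J hJ.1 hJ.2).le (abs_nonneg _)) (hθ j) ⟨h1, h2⟩
    exact sub_eq_zero.mp (abs_eq_zero.mp
      ((mul_eq_zero.mp h).resolve_left (hw j J h1 h2).ne'))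
  intro J
  induction J using Multiset.induction_on with
  | empty => simp
  | cons j J ih =>
    intro _ hδJ
    rw [Multiset.card_cons] at hδJ
    rcases J.empty_or_exists_mem with rfl | ⟨a, ha⟩
    · simpa using hX1 j
    · have h1 : 1 ≤ Multiset.card J := Multiset.card_pos_iff_exists_mem.mpr ⟨a, ha⟩
      rw [hrec j J h1 (by lia), ih h1 (by lia), Multiset.map_cons, Multiset.prod_cons]
end

section
/- Suppose x̄ ∈ Ω and (x̄, X̄) is a lifted point (X̄_∅ = 1, X̄_{{j}} = x̄_j for all j) satisfying the linearized constraints [φ_{c_r}]_L(X̄) ≥ β_r for r = 1,…,R1 and [φ_{c_r}]_L(X̄) = β_r for r = R1+1,…,R, together with all iterated RLT identities X̄_{J+{j}} = x̄_j · X̄_J for every j ∈ N and every multiset J with 1 ≤ |J| ≤ δ−1. Then x̄ is feasible for PP(Ω) and the linearized objective equals the true objective: [φ_{c_0}]_L(X̄) = φ_{c_0}(x̄). Consequently, when a node's relaxation solution has all RLT violations equal to zero, its objective value is the value of a PP(Ω)-feasible point. -/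
/-- Value of the polynomial with coefficient function `c` at `x`:
`φ_c(x) = ∑_J c(J) · ∏_{j∈J} x_j` (product with multiplicity). -/
noncomputable def phi {N : Type*} (c : Multiset N → ℝ) (x : N → ℝ) : ℝ :=
  ∑ᶠ J : Multiset N, c J * (J.map x).prod

/-- Linearization of the polynomial with coefficient function `c` at a lifted
point with RLT variables `X`: `[φ_c]_L(X) = ∑_J c(J) · X_J`. -/
noncomputable def lin {N : Type*} (c : Multiset N → ℝ) (X : Multiset N → ℝ) : ℝ :=
  ∑ᶠ J : Multiset N, c J * X J

/-- The RLT identities force every lifted monomial of degree at most `δ` to its true value. -/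
theorem lifted_eq_prod {N : Type*} {δ : ℕ} {x : N → ℝ} {X : Multiset N → ℝ}
    (hX0 : X 0 = 1) (hX1 : ∀ j, X {j} = x j)
    (hRLT : ∀ (j : N) (J : Multiset N), 1 ≤ Multiset.card J → Multiset.card J ≤ δ - 1 →
      X (j ::ₘ J) = x j * X J)
    (J : Multiset N) (hJ : Multiset.card J ≤ δ) : X J = (J.map x).prod := by
  induction J using Multiset.induction_on with
  | empty => simpa using hX0
  | cons j J ih =>
    rw [Multiset.card_cons] at hJ
    rcases Nat.eq_zero_or_pos (Multiset.card J) with h | h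
    · rw [Multiset.card_eq_zero.mp h]
      simpa using hX1 j
    · rw [hRLT j J h (by omega), ih (by omega), Multiset.map_cons, Multiset.prod_cons]

/-- Zero RLT violation makes the linearization of a polynomial of degree at most `δ` exact. -/
theorem lin_eq_phi {N : Type*} {δ : ℕ} {c : Multiset N → ℝ} {x : N → ℝ} {X : Multiset N → ℝ}
    (hc : ∀ J, δ < Multiset.card J → c J = 0)
    (hX : ∀ J, Multiset.card J ≤ δ → X J = (J.map x).prod) : lin c X = phi c x := by
  refine finsum_congr fun J => ?_
  rcases le_or_gt (Multiset.card J) δ with h | h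
  · rw [hX J h]
  · rw [hc J h, zero_mul, zero_mul]

/-- If a lifted point `(xb, Xb)` with `xb ∈ Ω` satisfies the
linearized constraints of `PP(Ω)` and all iterated RLT identities
`Xb_{J+{j}} = xb_j · Xb_J` for `1 ≤ |J| ≤ δ−1`, then `xb` is feasible for
`PP(Ω)` and the linearized objective equals the true objective. -/
theorem zero_rlt_violation_gives_feasible_point
    {N : Type*} [Fintype N] (δ : ℕ) (hδ : 1 ≤ δ)
    (l u : N → ℝ) (hlu : ∀ j, l j ≤ u j)
    (R1 R : ℕ) (hR1 : R1 ≤ R)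
    (c : ℕ → Multiset N → ℝ) (β : ℕ → ℝ)
    (hsupp : ∀ r, r ≤ R → ∀ J : Multiset N, δ < Multiset.card J → c r J = 0)
    (xb : N → ℝ) (Xb : Multiset N → ℝ)
    (hbox : ∀ j, l j ≤ xb j ∧ xb j ≤ u j)
    (hX0 : Xb (0 : Multiset N) = 1)
    (hX1 : ∀ j : N, Xb ({j} : Multiset N) = xb j)
    (hineq : ∀ r, 1 ≤ r → r ≤ R1 → β r ≤ lin (c r) Xb)
    (heq : ∀ r, R1 < r → r ≤ R → lin (c r) Xb = β r)
    (hRLT : ∀ (j : N) (J : Multiset N), 1 ≤ Multiset.card J → Multiset.card J ≤ δ - 1 →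
      Xb (j ::ₘ J) = xb j * Xb J) :
    ((∀ j, l j ≤ xb j ∧ xb j ≤ u j) ∧
     (∀ r, 1 ≤ r → r ≤ R1 → β r ≤ phi (c r) xb) ∧
     (∀ r, R1 < r → r ≤ R → phi (c r) xb = β r)) ∧
    lin (c 0) Xb = phi (c 0) xb := by
  have key : ∀ r, r ≤ R → lin (c r) Xb = phi (c r) xb := fun r hr =>
    lin_eq_phi (hsupp r hr) (lifted_eq_prod hX0 hX1 hRLT)
  refine ⟨⟨hbox, fun r h1 h2 => ?_, fun r h1 h2 => ?_⟩, key 0 (Nat.zero_le R)⟩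
  · rw [← key r (h2.trans hR1)]
    exact hineq r h1 h2
  · rw [← key r h2]
    exact heq r h1 h2
end
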